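/- For complex numbers a, b₁, b₂ with a not a nonpositive integer, and real x, y with |x| + |y| < 1 and |xy/((1−x)(1−y))| < 1: F₂(a; b₁, b₂; a, a; x, y) = (1−x)^{−b₁}(1−y)^{−b₂} · ₂F₁(b₁, b₂; a; xy/((1−x)(1−y))). -/

import Mathlib

/-- The Pochhammer symbol `(a)_n = a(a+1)⋯(a+n-1)`. -/
noncomputable def poch (a : ℂ) (n : ℕ) : ℂ := Polynomial.eval a (ascPochhammer ℂ n)

/-- `z` is not a nonpositive integer. -/
def NotNonposInt (z : ℂ) : Prop := ∀ m : ℕ, z ≠ -(m : ℂ)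

/-- Appell's second function `F₂(a; b₁, b₂; c₁, c₂; x, y)`. -/
noncomputable def F2 (a b₁ b₂ c₁ c₂ : ℂ) (x y : ℂ) : ℂ :=
  ∑' p : ℕ × ℕ,
    poch a (p.1 + p.2) * poch b₁ p.1 * poch b₂ p.2 /
      (poch c₁ p.1 * poch c₂ p.2 * (Nat.factorial p.1) * (Nat.factorial p.2)) *
      x ^ p.1 * y ^ p.2

/-- The Gauss hypergeometric series `₂F₁(a,b;c;x)`. -/
noncomputable def twoF1 (a b c x : ℂ) : ℂ :=
  ∑' k : ℕ, poch a k * poch b k / (poch c k * (Nat.factorial k)) * x ^ k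

theorem poch_zero (a : ℂ) : poch a 0 = 1 := by simp [poch]

theorem poch_succ (a : ℂ) (n : ℕ) : poch a (n + 1) = poch a n * (a + n) :=
  ascPochhammer_succ_eval n a

theorem poch_add (a : ℂ) (m n : ℕ) : poch a (m + n) = poch a m * poch (a + m) n := by
  induction n with
  | zero => simp [poch_zero]
  | succ n ih =>
    rw [← add_assoc, poch_succ, ih, poch_succ]
    push_cast
    ring

theorem poch_succ_left (a : ℂ) (n : ℕ) : poch a (n + 1) = a * poch (a + 1) n := by
  rw [add_comm, poch_add]
  simp [poch_succ, poch_zero]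

theorem NotNonposInt.add_natCast_ne_zero {a : ℂ} (ha : NotNonposInt a) (n : ℕ) :
    a + n ≠ 0 := fun h => ha n (eq_neg_of_add_eq_zero_left h)

theorem NotNonposInt.poch_ne_zero {a : ℂ} (ha : NotNonposInt a) (n : ℕ) : poch a n ≠ 0 := by
  induction n with
  | zero => simp [poch_zero]
  | succ n ih =>
    rw [poch_succ]
    exact mul_ne_zero ih (ha.add_natCast_ne_zero n)

theorem NotNonposInt.add_one {a : ℂ} (ha : NotNonposInt a) : NotNonposInt (a + 1) := by
  intro m h
  refine ha (m + 1) ?_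
  push_cast
  linear_combination h

/-- The Chu–Vandermonde summation formula. -/
theorem sum_choose_mul_descFactorial_div_poch {a : ℂ} (ha : NotNonposInt a) (m n : ℕ) :
    ∑ k ∈ Finset.range (m + 1), (m.choose k : ℂ) * n.descFactorial k / poch a k =
      poch (a + m) n / poch a n := by
  induction m generalizing a n with
  | zero => simp [poch_zero, ha.poch_ne_zero n]
  | succ m ih =>
    have hsplit : ∑ k ∈ Finset.range (m + 2),
        ((m + 1).choose k : ℂ) * n.descFactorial k / poch a k =
        ∑ k ∈ Finset.range (m + 1), (m.choose k : ℂ) * n.descFactorial k / poch a k +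
        ∑ k ∈ Finset.range (m + 1),
          (m.choose k : ℂ) * n.descFactorial (k + 1) / poch a (k + 1) := by
      have hlast : ∑ k ∈ Finset.range (m + 1), (m.choose k : ℂ) * n.descFactorial k / poch a k =
          ∑ k ∈ Finset.range (m + 2), (m.choose k : ℂ) * n.descFactorial k / poch a k := by
        simp [Finset.sum_range_succ _ (m + 1)]
      rw [hlast, Finset.sum_range_succ', Finset.sum_range_succ' _ (m + 1), add_right_comm,
        ← Finset.sum_add_distrib]
      congr 1
      · refine Finset.sum_congr rfl fun k _ => ?_
        rw [Nat.choose_succ_succ]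
        push_cast
        ring
      · simp
    rw [hsplit, ih ha]
    cases n with
    | zero => simp [poch_zero]
    | succ n =>
      have hshift : ∑ k ∈ Finset.range (m + 1),
          (m.choose k : ℂ) * (n + 1).descFactorial (k + 1) / poch a (k + 1) =
          (n + 1) / a * (poch (a + 1 + m) n / poch (a + 1) n) := by
        rw [← ih ha.add_one, Finset.mul_sum]
        refine Finset.sum_congr rfl fun k _ => ?_
        rw [Nat.succ_descFactorial_succ, poch_succ_left]
        push_cast
        ring
      have h0 : a ≠ 0 := by simpa using ha 0
      have h1 := ha.add_one.poch_ne_zero n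
      have e1 : poch (a + m) (n + 1) = (a + m) * poch (a + 1 + m) n := by
        rw [poch_succ_left, add_right_comm]
      have e2 : poch (a + (m + 1 : ℕ)) (n + 1) = poch (a + 1 + m) n * (a + 1 + m + n) := by
        rw [poch_succ]
        push_cast
        rw [show a + ((m : ℂ) + 1) = a + 1 + m by ring]
      rw [hshift, e1, e2, poch_succ_left a n]
      field_simp
      ring

theorem poch_add_div_poch_mul_poch {a : ℂ} (ha : NotNonposInt a) (m n : ℕ) :
    poch a (m + n) / (poch a m * poch a n) =
      ∑ k ∈ Finset.range (m + 1),
        (m.descFactorial k : ℂ) * n.descFactorial k / (poch a k * k.factorial) := by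
  have hm := ha.poch_ne_zero m
  rw [poch_add, mul_div_mul_left _ _ hm, ← sum_choose_mul_descFactorial_div_poch ha]
  refine Finset.sum_congr rfl fun k _ => ?_
  have hk := ha.poch_ne_zero k
  have hf : (k.factorial : ℂ) ≠ 0 := mod_cast k.factorial_ne_zero
  rw [Nat.descFactorial_eq_factorial_mul_choose m k]
  push_cast
  field_simp

theorem poch_ofReal_eq_norm {B : ℝ} (hB : 0 ≤ B) (n : ℕ) :
    poch B n = (‖poch B n‖ : ℝ) := by
  induction n with
  | zero => simp [poch_zero]
  | succ n ih =>
    have h : ‖(B : ℂ) + n‖ = B + n := by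
      rw [← Complex.ofReal_natCast, ← Complex.ofReal_add, Complex.norm_real]
      exact abs_of_nonneg (by positivity)
    rw [poch_succ, norm_mul, h]
    push_cast
    rw [← ih]

theorem norm_poch_le (b : ℂ) (n : ℕ) : ‖poch b n‖ ≤ ‖poch (‖b‖ : ℂ) n‖ := by
  induction n with
  | zero => simp [poch_zero]
  | succ n ih =>
    have h : ‖(‖b‖ : ℂ) + n‖ = ‖b‖ + n := by
      rw [← Complex.ofReal_natCast, ← Complex.ofReal_add, Complex.norm_real]
      exact abs_of_nonneg (by positivity)
    rw [poch_succ, poch_succ, norm_mul, norm_mul, h]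
    gcongr
    simpa using norm_add_le b n

theorem hasSum_poch_div_factorial_mul_pow (b : ℂ) {x : ℂ} (hx : ‖x‖ < 1) :
    HasSum (fun i : ℕ => poch b i / i.factorial * x ^ i) ((1 - x) ^ (-b)) := by
  have h := (Complex.one_div_one_sub_cpow_hasFPowerSeriesOnBall_zero b).hasSum
    (y := x) (by simpa [enorm_eq_nnnorm, ← NNReal.coe_lt_coe] using hx)
  rw [zero_add, one_div, ← Complex.cpow_neg] at h
  refine h.congr_fun fun i => ?_
  have hf : (i.factorial : ℂ) ≠ 0 := mod_cast i.factorial_ne_zero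
  have hc := Ring.factorial_nsmul_multichoose_eq_ascPochhammer b i
  rw [Ring.multichoose_eq, Polynomial.ascPochhammer_smeval_eq_eval, nsmul_eq_mul] at hc
  rw [FormalMultilinearSeries.ofScalars_apply_eq, smul_eq_mul, poch, ← hc,
    mul_div_cancel_left₀ _ hf]

/-- The summand of the binomial series shifted by `k`. -/
noncomputable def shiftedBinomialTerm (b x : ℂ) (k i : ℕ) : ℂ :=
  poch b (k + i) / i.factorial * x ^ (k + i)

theorem hasSum_shiftedBinomialTerm (b : ℂ) {x : ℂ} (hx : ‖x‖ < 1) (k : ℕ) :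
    HasSum (shiftedBinomialTerm b x k) ((1 - x) ^ (-b) * (poch b k * (x / (1 - x)) ^ k)) := by
  have h0 : 1 - x ≠ 0 := by
    intro h
    rw [← sub_eq_zero.mp h] at hx
    simp at hx
  have hval : (1 - x) ^ (-b) * (poch b k * (x / (1 - x)) ^ k) =
      poch b k * x ^ k * (1 - x) ^ (-(b + k)) := by
    rw [neg_add, Complex.cpow_add _ _ h0, Complex.cpow_neg _ (k : ℂ), Complex.cpow_natCast, div_pow]
    ring
  rw [hval]
  refine ((hasSum_poch_div_factorial_mul_pow (b + k) hx).mul_left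
    (poch b k * x ^ k)).congr_fun fun i => ?_
  rw [shiftedBinomialTerm, poch_add]
  ring

theorem hasSum_norm_shiftedBinomialTerm {B X : ℝ} (hB : 0 ≤ B) (hX : 0 ≤ X) (hX1 : X < 1)
    (k : ℕ) :
    HasSum (fun i => ‖shiftedBinomialTerm B X k i‖)
      ‖((1 - X : ℂ) ^ (-B : ℂ) * (poch B k * (X / (1 - X)) ^ k))‖ := by
  have h := hasSum_shiftedBinomialTerm B (x := X) (by simpa [abs_of_nonneg hX]) k
  have hn : Summable fun i => ‖shiftedBinomialTerm B X k i‖ := h.summable.norm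
  have hreal (i : ℕ) : shiftedBinomialTerm B X k i = (‖shiftedBinomialTerm B X k i‖ : ℝ) := by
    rw [shiftedBinomialTerm, norm_mul, norm_div, norm_pow, Complex.norm_natCast,
      Complex.norm_real, Real.norm_of_nonneg hX]
    push_cast
    rw [← poch_ofReal_eq_norm hB]
  have hc : HasSum (shiftedBinomialTerm B X k)
      ((∑' i, ‖shiftedBinomialTerm B X k i‖ : ℝ) : ℂ) := by
    rw [funext hreal]
    simpa using Complex.hasSum_ofReal.mpr hn.hasSum
  rw [h.unique hc, Complex.norm_real, Real.norm_of_nonneg (tsum_nonneg fun _ => norm_nonneg _)]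
  exact hn.hasSum

theorem norm_shiftedBinomialTerm_le (b x : ℂ) (k i : ℕ) :
    ‖shiftedBinomialTerm b x k i‖ ≤ ‖shiftedBinomialTerm (‖b‖ : ℂ) (‖x‖ : ℂ) k i‖ := by
  simp only [shiftedBinomialTerm, norm_mul, norm_div, norm_pow, Complex.norm_real, norm_norm]
  gcongr
  exact norm_poch_le b _

open Filter Topology in
theorem summable_twoF1 (a b : ℂ) {c : ℂ} (hc : NotNonposInt c) {z : ℂ} (hz : ‖z‖ < 1) :
    Summable fun k : ℕ => poch a k * poch b k / (poch c k * k.factorial) * z ^ k := by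
  obtain ⟨r, hzr, hr⟩ := exists_between hz
  refine summable_of_ratio_norm_eventually_le hr ?_
  have hlim : Tendsto (fun k : ℕ => ‖(a + 1 * k) / (c + 1 * k) * ((b + 1 * k) / (1 + 1 * k)) * z‖)
      atTop (𝓝 ‖z‖) := by
    simpa using (((tendsto_add_mul_div_add_mul_atTop_nhds a c (1 : ℂ) one_ne_zero).mul
      (tendsto_add_mul_div_add_mul_atTop_nhds b 1 (1 : ℂ) one_ne_zero)).mul_const z).norm
  filter_upwards [hlim.eventually_lt_const hzr] with k hk
  refine le_trans (le_of_eq ?_) (mul_le_mul_of_nonneg_right hk.le (norm_nonneg _))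
  rw [← norm_mul, poch_succ, poch_succ, poch_succ, Nat.factorial_succ]
  congr 1
  have h1 := hc.poch_ne_zero k
  have h2 := hc.add_natCast_ne_zero k
  have h3 : (k.factorial : ℂ) ≠ 0 := mod_cast k.factorial_ne_zero
  have h4 : (1 + k : ℂ) ≠ 0 := by norm_cast; omega
  have h5 : (k + 1 : ℂ) ≠ 0 := by norm_cast
  push_cast
  simp only [one_mul]
  field_simp
  ring

theorem summable_mul_shiftedBinomialTerm {a : ℂ} (ha : NotNonposInt a) (b₁ b₂ : ℂ) {x y : ℂ}
    (hxy : ‖x‖ + ‖y‖ < 1) :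
    Summable fun p : ℕ × ℕ × ℕ => shiftedBinomialTerm b₁ x p.1 p.2.1 *
      shiftedBinomialTerm b₂ y p.1 p.2.2 / (poch a p.1 * p.1.factorial) := by
  have hx0 := norm_nonneg x
  have hy0 := norm_nonneg y
  refine Summable.of_norm_bounded (g := fun p : ℕ × ℕ × ℕ =>
    ‖shiftedBinomialTerm (‖b₁‖ : ℂ) (‖x‖ : ℂ) p.1 p.2.1‖ *
    ‖shiftedBinomialTerm (‖b₂‖ : ℂ) (‖y‖ : ℂ) p.1 p.2.2‖ / ‖poch a p.1 * p.1.factorial‖) ?_ ?_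
  · have h₁ := hasSum_norm_shiftedBinomialTerm (norm_nonneg b₁) hx0 (by linarith)
    have h₂ := hasSum_norm_shiftedBinomialTerm (norm_nonneg b₂) hy0 (by linarith)
    have hinner (k : ℕ) := ((h₁ k).mul (h₂ k) ((h₁ k).summable.mul_of_nonneg (h₂ k).summable
      (fun _ => norm_nonneg _) fun _ => norm_nonneg _)).div_const ‖poch a k * k.factorial‖
    rw [summable_prod_of_nonneg (fun _ => by positivity)]
    refine ⟨fun k => (hinner k).summable, ?_⟩
    simp only [fun k => (hinner k).tsum_eq]
    have hr : ‖(‖x‖ / (1 - ‖x‖) * (‖y‖ / (1 - ‖y‖)) : ℂ)‖ < 1 := by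
      have hx1 : 0 < 1 - ‖x‖ := by linarith
      have hy1 : 0 < 1 - ‖y‖ := by linarith
      rw [div_mul_div_comm]
      norm_cast
      rw [Real.norm_of_nonneg (by positivity), div_lt_one (by positivity)]
      linarith
    refine ((summable_twoF1 (‖b₁‖ : ℂ) (‖b₂‖ : ℂ) ha hr).norm.mul_left
      (‖(1 - ‖x‖ : ℂ) ^ (-‖b₁‖ : ℂ)‖ * ‖(1 - ‖y‖ : ℂ) ^ (-‖b₂‖ : ℂ)‖)).congr fun k => ?_
    simp only [norm_mul, norm_div, norm_pow, mul_pow]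
    ring
  · intro p
    rw [norm_div, norm_mul]
    gcongr <;> exact norm_shiftedBinomialTerm_le ..

/-- Appell's `F₂` with both denominator parameters equal to `a`, over the complex numbers. -/
theorem F2_eq_cpow_mul_twoF1 {a : ℂ} (ha : NotNonposInt a) (b₁ b₂ : ℂ) {x y : ℂ}
    (hxy : ‖x‖ + ‖y‖ < 1) :
    F2 a b₁ b₂ a a x y =
      (1 - x) ^ (-b₁) * (1 - y) ^ (-b₂) * twoF1 b₁ b₂ a (x * y / ((1 - x) * (1 - y))) := by
  have hx : ‖x‖ < 1 := by linarith [norm_nonneg y]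
  have hy : ‖y‖ < 1 := by linarith [norm_nonneg x]
  have hS := summable_mul_shiftedBinomialTerm ha b₁ b₂ hxy
  have h₁ := hasSum_shiftedBinomialTerm b₁ hx
  have h₂ := hasSum_shiftedBinomialTerm b₂ hy
  have hright := hS.hasSum.prod_fiberwise fun k => ((h₁ k).mul (h₂ k)
    (summable_mul_of_summable_norm (h₁ k).summable.norm (h₂ k).summable.norm)).div_const
      (poch a k * k.factorial)
  have hinj : Function.Injective
      fun p : ℕ × ℕ × ℕ => ((p.1 + p.2.1, p.1 + p.2.2), p.1) := by
    rintro ⟨k, i, j⟩ ⟨k', i', j'⟩ h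
    simp only [Prod.mk.injEq] at h ⊢
    omega
  let g : (ℕ × ℕ) × ℕ → ℂ := fun q =>
    poch b₁ q.1.1 / q.1.1.factorial * x ^ q.1.1 * (poch b₂ q.1.2 / q.1.2.factorial * y ^ q.1.2) *
      ((q.1.1.descFactorial q.2 : ℂ) * q.1.2.descFactorial q.2 / (poch a q.2 * q.2.factorial))
  have hg : HasSum g (∑' p : ℕ × ℕ × ℕ, shiftedBinomialTerm b₁ x p.1 p.2.1 *
      shiftedBinomialTerm b₂ y p.1 p.2.2 / (poch a p.1 * p.1.factorial)) := by
    refine (hinj.hasSum_iff ?_).mp (hS.hasSum.congr_fun ?_)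
    · rintro ⟨⟨m, n⟩, k⟩ h
      have hlt : m < k ∨ n < k := by
        by_contra! hle
        exact h ⟨(k, m - k, n - k), by simp [hle.1, hle.2]⟩
      rcases hlt with hlt | hlt <;> simp [g, Nat.descFactorial_eq_zero_iff_lt.mpr hlt]
    · rintro ⟨k, i, j⟩
      have hfac (i : ℕ) : ((k + i).factorial : ℂ) = i.factorial * (k + i).descFactorial k := by
        rw [← Nat.factorial_mul_descFactorial (Nat.le_add_right k i)]
        simp
      have hne (i : ℕ) : ((k + i).descFactorial k : ℂ) ≠ 0 := by
        rw [Nat.cast_ne_zero, Ne, Nat.descFactorial_eq_zero_iff_lt]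
        omega
      have hf (i : ℕ) : (i.factorial : ℂ) ≠ 0 := mod_cast i.factorial_ne_zero
      have hi := hne i
      have hj := hne j
      have hi' := hf i
      have hj' := hf j
      have hk' := hf k
      have hk := ha.poch_ne_zero k
      simp only [Function.comp_apply, g, shiftedBinomialTerm, hfac]
      field_simp
  have hleft := hg.prod_fiberwise fun p => hasSum_sum_of_ne_finset_zero
    (s := Finset.range (p.1 + 1)) fun k hk => by
      have hlt : p.1 < k := by simpa using hk
      simp [g, Nat.descFactorial_eq_zero_iff_lt.mpr hlt]
  rw [F2, twoF1, ← tsum_mul_left]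
  trans
  · refine Eq.trans (tsum_congr fun p => ?_) hleft.tsum_eq
    simp only [g]
    rw [← Finset.mul_sum, ← poch_add_div_poch_mul_poch ha]
    ring
  · refine hright.tsum_eq.symm.trans (tsum_congr fun k => ?_)
    simp only [div_pow, mul_pow]
    ring

theorem F2_to_twoF1 (a b₁ b₂ : ℂ) (ha : NotNonposInt a)
    (x y : ℝ) (hxy : |x| + |y| < 1) (harg : |x * y / ((1 - x) * (1 - y))| < 1) :
    F2 a b₁ b₂ a a (x : ℂ) (y : ℂ) =
      ((1 : ℂ) - x) ^ (-b₁) * ((1 : ℂ) - y) ^ (-b₂) *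
        twoF1 b₁ b₂ a ((x : ℂ) * y / ((1 - (x : ℂ)) * (1 - (y : ℂ)))) :=
  F2_eq_cpow_mul_twoF1 ha b₁ b₂ (by simpa using hxy)
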